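/- Let M be an n \times k matrix over F_q with entries chosen independently and uniformly at random, and let X = {i : e_i \in rowspace(M)}. Then the probability that |X| \ge x equals q^{-nk} \sum_{r=x}^{min(n,k)} ( \sum_{i=x}^{r} \binom{k}{i} \sum_{j=0}^{k-i} (-1)^j \binom{k-i}{j} [k-i-j choose r-i-j]_q ) \prod_{\ell=0}^{r-1} (q^n - q^\ell). -/

import Mathlib

/-- The Gaussian binomial coefficient `[m, d]_q`. -/
def gaussBinom (q : ℕ) : ℕ → ℕ → ℕ
  | _, 0 => 1
  | 0, _ + 1 => 0
  | m + 1, d + 1 => gaussBinom q m d + q ^ (d + 1) * gaussBinom q m (d + 1)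

/-- Gaussian binomial with integer lower index, vanishing for negative index. -/
def gaussBinomZ (q m : ℕ) (d : ℤ) : ℕ :=
  if 0 ≤ d then gaussBinom q m d.toNat else 0

lemma qprod_succ (Q : ℚ) (m d : ℕ) : ∏ l ∈ Finset.range (d+1), (Q^(m+1) - Q^l)
    = (Q^(m+1) - 1) * Q^d * ∏ l ∈ Finset.range d, (Q^m - Q^l) := by
  rw [Finset.prod_range_succ']
  have : ∀ l, Q^(m+1) - Q^(l+1) = Q * (Q^m - Q^l) := fun l => by ring
  simp only [this, Finset.prod_mul_distrib, Finset.prod_const, Finset.card_range]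
  ring

lemma gaussBinom_mul (q m : ℕ) : ∀ d, (gaussBinom q m d : ℚ) * ∏ l ∈ Finset.range d, ((q:ℚ)^d - (q:ℚ)^l)
    = ∏ l ∈ Finset.range d, ((q:ℚ)^m - (q:ℚ)^l) := by
  induction m with
  | zero => 
    intro d
    cases d with
    | zero => simp [gaussBinom]
    | succ d => simp [gaussBinom, Finset.prod_range_succ']
  | succ m ih =>
    intro d
    cases d with
    | zero => simp [gaussBinom]
    | succ d =>
      have h1 := ih d
      have h2 := ih (d+1)
      rw [Finset.prod_range_succ (fun l => (q:ℚ)^m - (q:ℚ)^l)] at h2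
      rw [qprod_succ] at h2
      rw [gaussBinom, qprod_succ, qprod_succ]
      push_cast
      linear_combination (q:ℚ)^(d+1) * h2 + ((q:ℚ)^(d+1) - 1) * (q:ℚ)^d * h1

lemma alt_choose (k i c : ℕ) (hc : c ≤ k) :
    ∑ j ∈ Finset.range (k - i + 1), (-1:ℚ)^j * ((i+j).choose i : ℚ) * (c.choose (i+j) : ℚ)
      = if c = i then 1 else 0 := by
  have h : ∀ j, (-1:ℚ)^j * ((i+j).choose i : ℚ) * (c.choose (i+j) : ℚ)
      = c.choose i * ((-1)^j * ((c-i).choose j : ℚ)) := by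
    intro j
    have := Nat.choose_mul (n := c) (k := i+j) (s := i) (by omega)
    rw [Nat.add_sub_cancel_left] at this
    have : (c.choose (i+j) : ℚ) * (i+j).choose i = c.choose i * (c-i).choose j := by exact_mod_cast this
    linear_combination (-1)^j * this
  simp only [h, ← Finset.mul_sum]
  have h2 : ∑ j ∈ Finset.range (k - i + 1), ((-1:ℚ)^j * ((c-i).choose j : ℚ))
      = ∑ j ∈ Finset.range (c - i + 1), ((-1:ℚ)^j * ((c-i).choose j : ℚ)) := by
    symm
    apply Finset.sum_subset
    · intro j; simp; omega
    · intro j _ hj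
      rw [Nat.choose_eq_zero_of_lt (by simp at hj; omega)]; simp
  have h3 := Int.alternating_sum_range_choose (n := c - i)
  have h3 : ∑ j ∈ Finset.range (c - i + 1), ((-1:ℚ)^j * ((c-i).choose j : ℚ)) = if c - i = 0 then 1 else 0 := by
    exact_mod_cast congrArg (Int.cast : ℤ → ℚ) h3
  rw [h2, h3]
  rcases lt_trichotomy c i with h | h | h
  · rw [Nat.choose_eq_zero_of_lt h, if_neg h.ne]; simp
  · subst h; simp
  · rw [if_neg (by omega), if_neg (by omega)]; simp

open Module in
lemma span_top_iff {F : Type*} [Field F] {n r : ℕ} (A : Fin n → Fin r → F) :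
    Submodule.span F (Set.range A) = ⊤ ↔ LinearIndependent F (fun j i => A i j) := by
  rw [linearIndependent_iff_card_eq_finrank_span, Set.finrank]
  have h1 : (Matrix.of A).rank = finrank F (Submodule.span F (Set.range A)) :=
    (Matrix.of A).rank_eq_finrank_span_row
  have h2 : (Matrix.of A).transpose.rank =
      finrank F (Submodule.span F (Set.range (fun j i => A i j))) :=
    (Matrix.of A).transpose.rank_eq_finrank_span_row
  rw [Matrix.rank_transpose] at h2
  rw [← h2, h1]
  constructor
  · intro h
    rw [h]; simp
  · intro h
    apply Submodule.eq_top_of_finrank_eq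
    rw [← h]; simp

open Module in
lemma card_span_eq {F V : Type*} [Field F] [Fintype F] [AddCommGroup V] [Module F V] [Finite V]
    (n : ℕ) (W : Submodule F V) :
    (Nat.card {M : Fin n → V // Submodule.span F (Set.range M) = W} : ℚ) =
      ∏ l ∈ Finset.range (finrank F W), ((Fintype.card F : ℚ)^n - (Fintype.card F : ℚ)^l) := by
  set r := finrank F W with hr
  have : FiniteDimensional F W := Module.Finite.of_finite
  let e : W ≃ₗ[F] (Fin r → F) := LinearEquiv.ofFinrankEq _ _ (by simp [hr])
  have e1 : {M : Fin n → V // Submodule.span F (Set.range M) = W} ≃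
      {A : Fin r → Fin n → F // LinearIndependent F A} := by
    refine ⟨fun M => ⟨fun j i => e ⟨M.1 i, M.2.le (Submodule.subset_span ⟨i, rfl⟩)⟩ j, ?_⟩,
      fun A => ⟨fun i => (e.symm (fun j => A.1 j i) : W), ?_⟩, ?_, ?_⟩
    · refine (span_top_iff (fun i => e ⟨M.1 i, M.2.le (Submodule.subset_span ⟨i, rfl⟩)⟩)).1 ?_
      have h := M.2
      let N : Fin n → W := fun i => ⟨M.1 i, M.2.le (Submodule.subset_span ⟨i, rfl⟩)⟩
      have hN : Submodule.span F (Set.range N) = ⊤ := by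
        apply Submodule.map_injective_of_injective W.injective_subtype
        rw [Submodule.map_span, ← Set.range_comp, Submodule.map_top, Submodule.range_subtype]
        exact h
      change Submodule.span F (Set.range (e ∘ N)) = ⊤
      rw [Set.range_comp, ← LinearEquiv.coe_coe, ← Submodule.map_span, hN, Submodule.map_top]
      exact e.range
    · have h := (span_top_iff (fun i j => A.1 j i)).2 A.2
      change Submodule.span F (Set.range (W.subtype ∘ e.symm ∘ (fun i j => A.1 j i))) = W
      rw [Set.range_comp, Set.range_comp, ← LinearEquiv.coe_coe, ← Submodule.map_span, ← Submodule.map_span, h,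
        Submodule.map_top, LinearEquiv.range, Submodule.map_top, Submodule.range_subtype]
    · intro M; simp
    · intro A; simp
  rw [Nat.card_congr e1]
  by_cases hn : r ≤ n
  · rw [card_linearIndependent (by simpa using hn), Fin.prod_univ_eq_prod_range (fun l => Fintype.card F ^ _ - Fintype.card F ^ l)]
    push_cast
    apply Finset.prod_congr rfl
    intro l hl
    rw [Nat.cast_sub]
    · simp
    · apply Nat.pow_le_pow_right Fintype.card_pos
      simp at hl ⊢; omega
  · have : IsEmpty {A : Fin r → Fin n → F // LinearIndependent F A} := by
      constructor
      rintro ⟨A, hA⟩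
      have := hA.fintype_card_le_finrank
      simp at this; omega
    rw [Nat.card_of_isEmpty]
    symm
    rw [Nat.cast_zero]
    apply Finset.prod_eq_zero (i := n) (by simp; omega) (by simp)

open Module in
lemma card_subspaces {F V : Type*} [Field F] [Fintype F] [AddCommGroup V] [Module F V] [Finite V]
    (d : ℕ) :
    Nat.card {W : Submodule F V // finrank F W = d} = gaussBinom (Fintype.card F) (finrank F V) d := by
  have : FiniteDimensional F V := Module.Finite.of_finite
  have hq : 1 < (Fintype.card F : ℚ) := by exact_mod_cast Fintype.one_lt_card
  have hne : ∏ l ∈ Finset.range d, ((Fintype.card F:ℚ)^d - (Fintype.card F:ℚ)^l) ≠ 0 := by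
    rw [Finset.prod_ne_zero_iff]
    intro l hl
    have := pow_lt_pow_right₀ hq (Finset.mem_range.1 hl)
    exact (sub_pos.2 this).ne'
  have key := gaussBinom_mul (Fintype.card F) (finrank F V) d
  suffices h : (Nat.card {W : Submodule F V // finrank F W = d} : ℚ) * ∏ l ∈ Finset.range d, ((Fintype.card F:ℚ)^d - (Fintype.card F:ℚ)^l) = ∏ l ∈ Finset.range d, ((Fintype.card F:ℚ)^(finrank F V) - (Fintype.card F:ℚ)^l) by
    rw [← key] at h
    exact_mod_cast mul_right_cancel₀ hne h
  by_cases hd : d ≤ finrank F V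
  · have e : {s : Fin d → V // LinearIndependent F s} ≃
        (Σ W : {W : Submodule F V // finrank F W = d}, {s : Fin d → V // Submodule.span F (Set.range s) = W.1}) :=
      ⟨fun s => ⟨⟨Submodule.span F (Set.range s.1), by rw [finrank_span_eq_card s.2]; simp⟩, ⟨s.1, rfl⟩⟩,
       fun p => ⟨p.2.1, by
         rw [linearIndependent_iff_card_eq_finrank_span, Set.finrank, p.2.2, p.1.2]; simp⟩,
       fun s => rfl, by
         rintro ⟨⟨W, hW⟩, ⟨s, hs⟩⟩
         dsimp at hs
         subst hs
         rfl⟩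
    have hc := Nat.card_congr e
    classical
    have : Fintype {W : Submodule F V // finrank F W = d} := Fintype.ofFinite _
    rw [Nat.card_sigma] at hc
    have hc : (Nat.card {s : Fin d → V // LinearIndependent F s} : ℚ) = _ := congrArg (Nat.cast : ℕ → ℚ) hc
    push_cast at hc
    have h2 : ∀ W : {W : Submodule F V // finrank F W = d}, (Nat.card {s : Fin d → V // Submodule.span F (Set.range s) = W.1} : ℚ) = ∏ l ∈ Finset.range d, ((Fintype.card F:ℚ)^d - (Fintype.card F:ℚ)^l) := by
      intro W
      rw [card_span_eq, W.2]
    simp only [h2, Finset.sum_const, Finset.card_univ, nsmul_eq_mul] at hc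
    rw [Nat.card_eq_fintype_card, ← hc, card_linearIndependent hd, Fin.prod_univ_eq_prod_range (fun l => Fintype.card F ^ _ - Fintype.card F ^ l)]
    push_cast
    apply Finset.prod_congr rfl
    intro l hl
    rw [Nat.cast_sub]
    · simp
    · apply Nat.pow_le_pow_right Fintype.card_pos
      simp at hl; omega
  · have : IsEmpty {W : Submodule F V // finrank F W = d} := by
      constructor
      rintro ⟨W, hW⟩
      have := W.finrank_le
      omega
    rw [Nat.card_of_isEmpty]
    symm
    rw [Nat.cast_zero, zero_mul]
    apply Finset.prod_eq_zero (i := finrank F V) (by simp; omega) (by simp)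

open Module in
lemma finrank_comap_mkQ {F V : Type*} [Field F] [AddCommGroup V] [Module F V]
    [FiniteDimensional F V] (U : Submodule F V) (P : Submodule F (V ⧸ U)) :
    finrank F (P.comap U.mkQ) = finrank F P + finrank F U := by
  have h1 := LinearMap.finrank_range_add_finrank_ker (P.mkQ ∘ₗ U.mkQ)
  have hk : LinearMap.ker (P.mkQ ∘ₗ U.mkQ) = P.comap U.mkQ := by
    rw [LinearMap.ker_comp, Submodule.ker_mkQ]
  have hr : LinearMap.range (P.mkQ ∘ₗ U.mkQ) = ⊤ := by
    rw [LinearMap.range_eq_top]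
    exact (Submodule.mkQ_surjective _).comp (Submodule.mkQ_surjective _)
  rw [hk, hr, finrank_top] at h1
  have h2 := P.finrank_quotient_add_finrank
  have h3 := U.finrank_quotient_add_finrank
  omega

open Module in
lemma card_subspaces_ge {F V : Type*} [Field F] [Fintype F] [AddCommGroup V] [Module F V] [Finite V]
    (U : Submodule F V) (r : ℕ) :
    Nat.card {W : Submodule F V // finrank F W = r ∧ U ≤ W} =
      gaussBinomZ (Fintype.card F) (finrank F V - finrank F U) ((r : ℤ) - finrank F U) := by
  have : FiniteDimensional F V := Module.Finite.of_finite
  have hU := U.finrank_quotient_add_finrank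
  unfold gaussBinomZ
  split_ifs with h
  · have hfin : Finite (V ⧸ U) := Finite.of_surjective _ U.mkQ_surjective
    rw [show finrank F V - finrank F U = finrank F (V ⧸ U) by omega, ← card_subspaces]
    symm
    apply Nat.card_congr
    refine ⟨fun P => ⟨P.1.comap U.mkQ, ?_, Submodule.le_comap_mkQ _ _⟩,
      fun W => ⟨W.1.map U.mkQ, ?_⟩, ?_, ?_⟩
    · rw [finrank_comap_mkQ, P.2]; omega
    · have := finrank_comap_mkQ U (W.1.map U.mkQ)
      rw [Submodule.comap_map_mkQ, sup_eq_right.2 W.2.2, W.2.1] at this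
      omega
    · intro P
      apply Subtype.ext
      exact Submodule.map_comap_eq_self (by simp)
    · intro W
      apply Subtype.ext
      simp [Submodule.comap_map_mkQ, W.2.2]
  · rw [Nat.card_eq_zero]
    left
    constructor
    rintro ⟨W, h1, h2⟩
    have := Submodule.finrank_mono h2
    omega

open Module in
lemma finrank_coord {F : Type*} [Field F] {k : ℕ} (T : Finset (Fin k)) :
    finrank F (Submodule.span F ((fun i => (Pi.single i (1:F) : Fin k → F)) '' (T : Set (Fin k)))) = T.card := by
  have hl : LinearIndependent F (fun i : T => (Pi.single i.1 (1:F) : Fin k → F)) := by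
    have := (Pi.basisFun F (Fin k)).linearIndependent.comp (Subtype.val : T → Fin k) Subtype.val_injective
    convert this using 1
    ext i; simp
  have h := finrank_span_eq_card hl
  rw [Fintype.card_coe] at h
  rw [← h, Set.image_eq_range]
  rfl

open Classical in
/-- The set of decodable coordinates. -/
noncomputable def decSet {F : Type*} [Field F] {k : ℕ} (W : Submodule F (Fin k → F)) : Finset (Fin k) :=
  Finset.univ.filter fun i => (Pi.single i (1:F) : Fin k → F) ∈ W

lemma mem_decSet {F : Type*} [Field F] {k : ℕ} (W : Submodule F (Fin k → F)) (i : Fin k) :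
    i ∈ decSet W ↔ (Pi.single i (1:F) : Fin k → F) ∈ W := by
  simp [decSet]

lemma subset_decSet {F : Type*} [Field F] {k : ℕ} (W : Submodule F (Fin k → F)) (T : Finset (Fin k)) :
    T ⊆ decSet W ↔ Submodule.span F ((fun i => (Pi.single i (1:F) : Fin k → F)) '' (T : Set (Fin k))) ≤ W := by
  rw [Submodule.span_le]
  constructor
  · rintro h _ ⟨i, hi, rfl⟩
    exact (mem_decSet _ _).1 (h hi)
  · intro h i hi
    exact (mem_decSet _ _).2 (h ⟨i, hi, rfl⟩)

open Module in
lemma card_decSet_le {F : Type*} [Field F] {k : ℕ} (W : Submodule F (Fin k → F)) :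
    (decSet W).card ≤ finrank F W := by
  have h := (subset_decSet W (decSet W)).1 (Finset.Subset.refl _)
  rw [← finrank_coord (F := F)]
  exact Submodule.finrank_mono h

open Module Classical in
lemma sum_choose_decSet {F : Type*} [Field F] [Fintype F] {k : ℕ} [Fintype (Submodule F (Fin k → F))]
    (r t : ℕ) :
    ∑ W ∈ Finset.univ.filter (fun W : Submodule F (Fin k → F) => finrank F W = r), ((decSet W).card.choose t)
      = k.choose t * gaussBinomZ (Fintype.card F) (k - t) ((r:ℤ) - t) := by
  have h1 : ∀ W : Submodule F (Fin k → F), (decSet W).card.choose t =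
      ∑ T ∈ (Finset.univ : Finset (Fin k)).powersetCard t, if T ⊆ decSet W then 1 else 0 := by
    intro W
    rw [← Finset.card_powersetCard, Finset.sum_boole, Nat.cast_id]
    congr 1
    ext T
    simp [Finset.mem_powersetCard, and_comm]
  simp only [h1]
  rw [Finset.sum_comm]
  rw [Finset.sum_congr rfl (g := fun _ => gaussBinomZ (Fintype.card F) (k - t) ((r:ℤ) - t))]
  · simp
  · intro T hT
    have hT := (Finset.mem_powersetCard.1 hT).2
    have := card_subspaces_ge (Submodule.span F ((fun i => (Pi.single i (1:F) : Fin k → F)) '' (T : Set (Fin k)))) r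
    rw [finrank_coord, hT, finrank_fin_fun] at this
    rw [← this, Finset.sum_boole, Finset.filter_filter, Nat.card_eq_fintype_card, Fintype.card_subtype, Nat.cast_id]
    simp only [subset_decSet]

open Module Classical in
lemma sum_exact {F : Type*} [Field F] [Fintype F] {k : ℕ} [Fintype (Submodule F (Fin k → F))]
    (r i : ℕ) (hi : i ≤ k) :
    ∑ W ∈ Finset.univ.filter (fun W : Submodule F (Fin k → F) => finrank F W = r), (if (decSet W).card = i then (1:ℚ) else 0)
      = (k.choose i : ℚ) * ∑ j ∈ Finset.range (k - i + 1), (-1 : ℚ) ^ j * ((k - i).choose j : ℚ) *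
                  (gaussBinomZ (Fintype.card F) (k - i - j) ((r : ℤ) - i - j) : ℚ) := by
  have hc : ∀ W : Submodule F (Fin k → F), (decSet W).card ≤ k := fun W => by
    simpa using (decSet W).card_le_univ
  simp only [← alt_choose k i _ (hc _)]
  rw [Finset.sum_comm, Finset.mul_sum]
  apply Finset.sum_congr rfl
  intro j hj
  rw [← Finset.mul_sum]
  have h := congrArg (Nat.cast : ℕ → ℚ) (sum_choose_decSet (F := F) (k := k) r (i+j))
  push_cast at h
  rw [h]
  have h2 := Nat.choose_mul (n := k) (k := i+j) (s := i) (by omega)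
  rw [Nat.add_sub_cancel_left] at h2
  have h2 : (k.choose (i+j) : ℚ) * (i+j).choose i = k.choose i * (k-i).choose j := by exact_mod_cast h2
  rw [← Nat.sub_sub, ← sub_sub]
  linear_combination (-1)^j * (gaussBinomZ (Fintype.card F) (k - i - j) ((r : ℤ) - i - j) : ℚ) * h2

open Module in
/-- Proposition 1 (non-systematic RLNC): for a uniformly random `n × k` matrix `M`
over `F_q` with `X = {i : e_i ∈ rowspace M}`, the probability that `|X| ≥ x` equals
`q^{-nk} ∑_{r=x}^{min(n,k)} (∑_{i=x}^{r} C(k,i) ∑_{j=0}^{k-i} (-1)^j C(k-i,j)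
[k-i-j, r-i-j]_q) ∏_{ℓ<r} (q^n - q^ℓ)`. -/
theorem prob_decode_at_least_x_nonsystematic {q n k x : ℕ} (F : Type*) [Field F] [Fintype F]
    (hF : Fintype.card F = q) (hxk : x ≤ k) :
    ({M : Matrix (Fin n) (Fin k) F |
        x ≤ {i | Pi.single i (1 : F) ∈
              Submodule.span F (Set.range fun r => M r)}.ncard}.ncard : ℚ)
      / (q : ℚ) ^ (n * k)
    = (1 / (q : ℚ) ^ (n * k)) *
        ∑ r ∈ Finset.Icc x (min n k),
          (∑ i ∈ Finset.Icc x r, (k.choose i : ℚ) *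
              ∑ j ∈ Finset.range (k - i + 1),
                (-1 : ℚ) ^ j * ((k - i).choose j : ℚ) *
                  (gaussBinomZ q (k - i - j) ((r : ℤ) - i - j) : ℚ)) *
            ∏ ℓ ∈ Finset.range r, ((q : ℚ) ^ n - (q : ℚ) ^ ℓ) := by
  classical
  subst hF
  rw [div_eq_mul_one_div, mul_comm]
  congr 1
  have : Fintype (Submodule F (Fin k → F)) := Fintype.ofFinite _
  have hset : {M : Matrix (Fin n) (Fin k) F | x ≤ {i | Pi.single i (1 : F) ∈
              Submodule.span F (Set.range fun r => M r)}.ncard} =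
      {M : Fin n → Fin k → F | x ≤ (decSet (Submodule.span F (Set.range M))).card} := by
    ext M
    change x ≤ _ ↔ x ≤ _
    rw [← Set.ncard_coe_finset]
    congr! 2
    ext i
    simp [decSet]
  rw [congrArg Set.ncard hset]
  have hcount : ({M : Fin n → Fin k → F | x ≤ (decSet (Submodule.span F (Set.range M))).card}.ncard : ℚ)
      = ∑ W : Submodule F (Fin k → F), (if x ≤ (decSet W).card then (1:ℚ) else 0) *
        ∏ l ∈ Finset.range (finrank F W), ((Fintype.card F : ℚ)^n - (Fintype.card F : ℚ)^l) := by
    rw [Set.ncard_eq_toFinset_card', Finset.card_eq_sum_card_fiberwise (t := Finset.univ)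
      (f := fun M : Fin n → Fin k → F => Submodule.span F (Set.range M)) (fun _ _ => by simp)]
    push_cast
    apply Finset.sum_congr rfl
    intro W _
    rw [← card_span_eq n W, Nat.card_eq_fintype_card, Fintype.card_subtype]
    split_ifs with h
    · rw [one_mul]
      congr 2
      ext M
      simp only [Finset.mem_filter, Set.mem_toFinset, Set.mem_ofPred_eq, Finset.mem_univ, true_and]
      constructor
      · exact fun h => h.2
      · intro h'; exact ⟨by rw [h']; exact h, h'⟩
    · rw [zero_mul, Nat.cast_eq_zero, Finset.card_eq_zero, Finset.filter_eq_empty_iff]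
      intro M hM h'
      simp only [Set.mem_toFinset, Set.mem_ofPred_eq] at hM
      rw [h'] at hM
      exact h hM
  refine Eq.trans hcount ?_
  rw [← Finset.sum_fiberwise_of_maps_to (s := Finset.univ) (t := Finset.range (k+1))
    (g := fun W : Submodule F (Fin k → F) => finrank F W)
    (fun W _ => by have := W.finrank_le; simp at this ⊢; omega)]
  symm
  have hsub : Finset.Icc x (min n k) ⊆ Finset.range (k+1) := by
    intro r hr
    rw [Finset.mem_Icc] at hr
    rw [Finset.mem_range]
    omega
  rw [← Finset.sum_subset hsub]
  · apply Finset.sum_congr rfl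
    intro r hr
    rw [Finset.mem_Icc] at hr
    rw [Finset.sum_congr rfl (g := fun i => ∑ W ∈ Finset.univ.filter (fun W : Submodule F (Fin k → F) => finrank F W = r),
      (if (decSet W).card = i then (1:ℚ) else 0))
      (fun i hi => (sum_exact r i (by simp at hi; omega)).symm)]
    rw [Finset.sum_comm, Finset.sum_mul]
    apply Finset.sum_congr rfl
    intro W hW
    have hW := (Finset.mem_filter.1 hW).2
    have hle := card_decSet_le W
    rw [hW] at hle ⊢
    congr 1
    rw [Finset.sum_ite_eq]
    simp [hle]
  · intro r hr hr'
    apply Finset.sum_eq_zero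
    intro W hW
    have hW := (Finset.mem_filter.1 hW).2
    have hle := card_decSet_le W
    rw [hW] at hle ⊢
    by_cases hx : x ≤ (decSet W).card
    · have : n < r := by
        simp at hr hr'; omega
      rw [Finset.prod_eq_zero (i := n) (by simpa using this) (by simp), mul_zero]
    · rw [if_neg hx, zero_mul]
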